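/- arXiv:math/0506130 — 2 statements merged into one kernel-verified Lean document; each statement's English description precedes it below -/
import Mathlib

section
/- For every integer n ≥ 1, the explicit vector fields on ℝ², K(x,y) = (2, 0), H_n(x,y) = (2·sin x·(1 + yⁿ), (2/n)·cos x·(2y + y^{n+1})), L_n(x,y) = (2·cos x·(1 + yⁿ), −(2/n)·sin x·(2y + y^{n+1})), satisfy the sl(2,ℝ) Lie bracket relations at every point p ∈ ℝ²: DH_n(p)(K(p)) − DK(p)(H_n(p)) = 2·L_n(p), DL_n(p)(K(p)) − DK(p)(L_n(p)) = −2·H_n(p), and DL_n(p)(H_n(p)) − DH_n(p)(L_n(p)) = −2·K(p). (For n = 1 these are the infinitesimal generators of the projective compactification of the hyperbolic plane, and for n = 2 those of the conformal compactification; the relations match [K,H] = 2L, [K,L] = −2H, [H,L] = −2K for the matrices H = ((1,0),(0,−1)), K = ((0,−1),(1,0)), L = ((0,1),(1,0)) in sl(2,ℝ).) -/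
/-- The infinitesimal generator `K̄` of the compactified actions. -/
def Kfield : ℝ × ℝ → ℝ × ℝ := fun _ => (2, 0)

/-- The infinitesimal generator `H̄ₙ` of the `n`-th compactified action. -/
noncomputable def Hfield (n : ℕ) : ℝ × ℝ → ℝ × ℝ := fun p =>
  (2 * Real.sin p.1 * (1 + p.2 ^ n),
   (2 / (n : ℝ)) * Real.cos p.1 * (2 * p.2 + p.2 ^ (n + 1)))

/-- The infinitesimal generator `L̄ₙ` of the `n`-th compactified action. -/
noncomputable def Lfield (n : ℕ) : ℝ × ℝ → ℝ × ℝ := fun p =>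
  (2 * Real.cos p.1 * (1 + p.2 ^ n),
   -((2 / (n : ℝ)) * Real.sin p.1 * (2 * p.2 + p.2 ^ (n + 1))))

/-- The derivative of a planar vector field whose components are products of one-variable
functions. -/
theorem fderiv_prodMk_mul_apply {f g a b : ℝ → ℝ} {f' g' a' b' : ℝ} {p : ℝ × ℝ}
    (hf : HasDerivAt f f' p.1) (ha : HasDerivAt a a' p.2)
    (hg : HasDerivAt g g' p.1) (hb : HasDerivAt b b' p.2) (v : ℝ × ℝ) :
    fderiv ℝ (fun q : ℝ × ℝ => (f q.1 * a q.2, g q.1 * b q.2)) p v =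
      (f' * a p.2 * v.1 + f p.1 * a' * v.2, g' * b p.2 * v.1 + g p.1 * b' * v.2) := by
  have h₁ : HasFDerivAt Prod.fst (ContinuousLinearMap.fst ℝ ℝ ℝ) p := hasFDerivAt_fst
  have h₂ : HasFDerivAt Prod.snd (ContinuousLinearMap.snd ℝ ℝ ℝ) p := hasFDerivAt_snd
  have h := ((hf.comp_hasFDerivAt p h₁).mul (ha.comp_hasFDerivAt p h₂)).prodMk
    ((hg.comp_hasFDerivAt p h₁).mul (hb.comp_hasFDerivAt p h₂))
  refine (congrArg (fun T => T v) h.fderiv).trans ?_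
  ext <;> simp <;> ring

theorem hasDerivAt_one_add_pow (n : ℕ) (y : ℝ) :
    HasDerivAt (fun y : ℝ => 1 + y ^ n) (n * y ^ (n - 1)) y :=
  (hasDerivAt_pow n y).const_add 1

theorem hasDerivAt_two_mul_add_pow_succ (n : ℕ) (y : ℝ) :
    HasDerivAt (fun y : ℝ => 2 * y + y ^ (n + 1)) (2 + (n + 1) * y ^ n) y := by
  simpa [Pi.add_def] using ((hasDerivAt_id y).const_mul 2).add (hasDerivAt_pow (n + 1) y)

theorem fderiv_Hfield_apply (n : ℕ) (p v : ℝ × ℝ) :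
    fderiv ℝ (Hfield n) p v =
      (2 * Real.cos p.1 * (1 + p.2 ^ n) * v.1 + 2 * Real.sin p.1 * (n * p.2 ^ (n - 1)) * v.2,
       2 / (n : ℝ) * -Real.sin p.1 * (2 * p.2 + p.2 ^ (n + 1)) * v.1
        + 2 / (n : ℝ) * Real.cos p.1 * (2 + (n + 1) * p.2 ^ n) * v.2) :=
  fderiv_prodMk_mul_apply ((Real.hasDerivAt_sin p.1).const_mul 2) (hasDerivAt_one_add_pow n p.2)
    ((Real.hasDerivAt_cos p.1).const_mul (2 / (n : ℝ)))
    (hasDerivAt_two_mul_add_pow_succ n p.2) v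

theorem fderiv_Lfield_apply (n : ℕ) (p v : ℝ × ℝ) :
    fderiv ℝ (Lfield n) p v =
      (2 * -Real.sin p.1 * (1 + p.2 ^ n) * v.1 + 2 * Real.cos p.1 * (n * p.2 ^ (n - 1)) * v.2,
       -(2 / (n : ℝ) * Real.cos p.1) * (2 * p.2 + p.2 ^ (n + 1)) * v.1
        + -(2 / (n : ℝ) * Real.sin p.1) * (2 + (n + 1) * p.2 ^ n) * v.2) := by
  have hL : Lfield n = fun q : ℝ × ℝ => (2 * Real.cos q.1 * (1 + q.2 ^ n),
      -(2 / (n : ℝ) * Real.sin q.1) * (2 * q.2 + q.2 ^ (n + 1))) := by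
    funext q
    simp only [Lfield, neg_mul]
  rw [hL]
  exact fderiv_prodMk_mul_apply ((Real.hasDerivAt_cos p.1).const_mul 2)
    (hasDerivAt_one_add_pow n p.2) ((Real.hasDerivAt_sin p.1).const_mul (2 / (n : ℝ))).neg
    (hasDerivAt_two_mul_add_pow_succ n p.2) v

/-- The vector fields `K̄`, `H̄ₙ`, `L̄ₙ` satisfy the `sl(2,ℝ)` bracket relations
`[K,H] = 2L`, `[K,L] = −2H`, `[H,L] = −2K` at every point of `ℝ²`. -/
theorem infinitesimal_generators_sl2_relations (n : ℕ) (hn : 1 ≤ n) (p : ℝ × ℝ) :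
    fderiv ℝ (Hfield n) p (Kfield p) - fderiv ℝ Kfield p (Hfield n p)
        = (2 : ℝ) • Lfield n p ∧
    fderiv ℝ (Lfield n) p (Kfield p) - fderiv ℝ Kfield p (Lfield n p)
        = (-2 : ℝ) • Hfield n p ∧
    fderiv ℝ (Lfield n) p (Hfield n p) - fderiv ℝ (Hfield n) p (Lfield n p)
        = (-2 : ℝ) • Kfield p := by
  have hK : fderiv ℝ Kfield p = 0 := fderiv_const_apply _
  refine ⟨?_, ?_, ?_⟩
  · rw [hK, fderiv_Hfield_apply]
    ext <;> simp [Kfield, Lfield] <;> ring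
  · rw [hK, fderiv_Lfield_apply]
    ext <;> simp [Kfield, Hfield] <;> ring
  · obtain ⟨m, rfl⟩ := Nat.exists_eq_add_of_le' hn
    rw [fderiv_Lfield_apply, fderiv_Hfield_apply]
    ext
    · simp only [Hfield, Lfield, Kfield, Prod.fst_sub, Prod.smul_fst, smul_eq_mul,
        Nat.add_sub_cancel]
      field_simp
      linear_combination -Real.sin_sq_add_cos_sq p.1
    · simp only [Hfield, Lfield, Kfield, Prod.snd_sub, Prod.smul_snd, smul_eq_mul]
      ring
end

section
/- Let α, β ≥ 1 be integers and work in the polynomial ring ℝ[t₁, t₂]. Set P₁ = α·t₁ + β·t₂, P₂ = (α(α−1)/2)·t₁² + αβ·t₁t₂ + (β(β−1)/2)·t₂², and P₂' = (t₁ − t₂)². Then the ℝ-subalgebras generated by {P₁, P₂} and by {P₁, P₂'} coincide: ℝ[P₁, P₂] = ℝ[P₁, P₂']. -/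
open MvPolynomial

/-- Replacing a generator `R` by `c • P ^ 2 + d • R` with `d ≠ 0` does not change the subalgebra
generated by `P` and `R`. -/
theorem Algebra.adjoin_pair_smul_sq_add_smul {K A : Type*} [Field K] [CommRing A] [Algebra K A]
    (P R : A) (c : K) {d : K} (hd : d ≠ 0) :
    Algebra.adjoin K {P, c • P ^ 2 + d • R} = Algebra.adjoin K {P, R} := by
  have mem_left (Q : A) : P ∈ Algebra.adjoin K {P, Q} := Algebra.subset_adjoin (by simp)
  have mem_right (Q : A) : Q ∈ Algebra.adjoin K {P, Q} := Algebra.subset_adjoin (by simp)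
  apply le_antisymm <;> refine Algebra.adjoin_le (Set.pair_subset (mem_left _) ?_)
  · exact add_mem (Subalgebra.smul_mem _ (pow_mem (mem_left R) 2) c)
      (Subalgebra.smul_mem _ (mem_right R) d)
  · have hR : R = d⁻¹ • ((c • P ^ 2 + d • R) - c • P ^ 2) := by
      rw [add_sub_cancel_left, inv_smul_smul₀ hd]
    rw [SetLike.mem_coe]
    nth_rewrite 2 [hR]
    exact Subalgebra.smul_mem _ (sub_mem (mem_right _)
      (Subalgebra.smul_mem _ (pow_mem (mem_left _) 2) c)) d⁻¹

/-- In `ℝ[t₁,t₂]`, with `P₁ = αt₁ + βt₂`,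
`P₂ = (α(α−1)/2)t₁² + αβ t₁t₂ + (β(β−1)/2)t₂²` and `P₂' = (t₁ − t₂)²`
(for integers `α, β ≥ 1`), the subalgebras `ℝ[P₁, P₂]` and `ℝ[P₁, P₂']`
coincide. -/
theorem adjoin_P1_P2_eq_adjoin_P1_P2' (α β : ℕ) (hα : 1 ≤ α) (hβ : 1 ≤ β) :
    Algebra.adjoin ℝ
      ({C (α : ℝ) * X 0 + C (β : ℝ) * X 1,
        C ((α : ℝ) * ((α : ℝ) - 1) / 2) * X 0 ^ 2
          + C ((α : ℝ) * (β : ℝ)) * (X 0 * X 1)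
          + C ((β : ℝ) * ((β : ℝ) - 1) / 2) * X 1 ^ 2} :
        Set (MvPolynomial (Fin 2) ℝ)) =
    Algebra.adjoin ℝ
      ({C (α : ℝ) * X 0 + C (β : ℝ) * X 1, (X 0 - X 1) ^ 2} :
        Set (MvPolynomial (Fin 2) ℝ)) := by
  have ha : (0 : ℝ) < α := by exact_mod_cast hα
  have hb : (0 : ℝ) < β := by exact_mod_cast hβ
  generalize (α : ℝ) = a at *
  generalize (β : ℝ) = b at *
  have hab : a + b ≠ 0 := (add_pos ha hb).ne'
  obtain ⟨c, hc⟩ : ∃ c, c = (a + b - 1) / (2 * (a + b)) := ⟨_, rfl⟩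
  obtain ⟨d, hd⟩ : ∃ d, d = -(a * b) / (2 * (a + b)) := ⟨_, rfl⟩
  have hd0 : d ≠ 0 := by
    rw [hd]
    exact div_ne_zero (neg_ne_zero.2 (mul_pos ha hb).ne') (mul_ne_zero two_ne_zero hab)
  have h₀ : a * (a - 1) / 2 = c * a ^ 2 + d := by rw [hc, hd]; field_simp; ring
  have h₁ : a * b = 2 * (c * (a * b)) - 2 * d := by rw [hc, hd]; field_simp; ring
  have h₂ : b * (b - 1) / 2 = c * b ^ 2 + d := by rw [hc, hd]; field_simp; ring
  rw [← Algebra.adjoin_pair_smul_sq_add_smul _ ((X 0 - X 1) ^ 2) c hd0, h₀, h₁, h₂]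
  congr 3
  simp only [smul_eq_C_mul, map_add, map_sub, map_mul, map_pow, map_ofNat]
  ring
end
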